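/- Let R ∈ B(H) be a proper partial isometry (neither isometry nor coisometry) satisfying (1 - R*R) Rⁿ (1 - RR*) = 0 for all n ≥ 0. Then there is a unital *-homomorphism π : C*(S ⊕ S*) → C*(R) with π(S ⊕ S*) = R, where S is the unilateral shift; i.e., C*(S ⊕ S*) maps onto any C*-algebra generated by such a partial isometry. -/

import Mathlib

open ContinuousLinearMap
set_option synthInstance.maxHeartbeats 1000000
set_option maxHeartbeats 1000000

open Filter Topology
open scoped CStarAlgebra

/-- A star homomorphism maps the C*-algebra generated by `a` into the one generated by `f a`. -/
theorem map_mem_elemental {A B : Type*} [CStarAlgebra A] [CStarAlgebra B] (f : A →⋆ₐ[ℂ] B)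
    {a z : A} (hz : z ∈ StarAlgebra.elemental ℂ a) : f z ∈ StarAlgebra.elemental ℂ (f a) := by
  have hf : Continuous f := map_continuous f
  have h : StarAlgebra.elemental ℂ a ≤ (StarAlgebra.elemental ℂ (f a)).comap f :=
    StarAlgebra.elemental.le_of_mem ((StarAlgebra.elemental.isClosed ℂ _).preimage hf)
      (StarAlgebra.elemental.self_mem ℂ (f a))
  exact h hz

/-- If the first coordinate is injective on the C*-algebra generated by `(a, b)`, then `a ↦ g b`
extends to a unital star homomorphism between the generated C*-algebras. -/
theorem exists_elemental_starAlgHom_of_prod {A B C : Type*} [CStarAlgebra A] [CStarAlgebra B]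
    [CStarAlgebra C] (a : A) (b : B) (g : B →⋆ₐ[ℂ] C)
    (hinj : ∀ z ∈ StarAlgebra.elemental ℂ (a, b), z.1 = 0 → z.2 = 0) :
    ∃ π : StarAlgebra.elemental ℂ a →⋆ₐ[ℂ] StarAlgebra.elemental ℂ (g b),
      π ⟨a, StarAlgebra.elemental.self_mem ℂ a⟩ =
        ⟨g b, StarAlgebra.elemental.self_mem ℂ (g b)⟩ := by
  let D := StarAlgebra.elemental ℂ (a, b)
  let f₀ : D →⋆ₐ[ℂ] A := (StarAlgHom.fst ℂ A B).comp D.subtype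
  let f : D →⋆ₐ[ℂ] StarAlgebra.elemental ℂ a :=
    f₀.codRestrict (StarAlgebra.elemental ℂ a) fun z =>
      map_mem_elemental (StarAlgHom.fst ℂ A B) (a := (a, b)) (z := z) z.2
  let k : D →⋆ₐ[ℂ] StarAlgebra.elemental ℂ (g b) :=
    ((g.comp (StarAlgHom.snd ℂ A B)).comp D.subtype).codRestrict
      (StarAlgebra.elemental ℂ (g b)) fun z =>
      map_mem_elemental (g.comp (StarAlgHom.snd ℂ A B)) (a := (a, b)) (z := z) z.2
  have hf₀ : Function.Injective f₀ := by
    refine (injective_iff_map_eq_zero f₀).2 fun z hz => ?_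
    exact Subtype.ext (Prod.ext hz (hinj z z.2 hz))
  have hf : Function.Bijective f := by
    refine ⟨fun x y hxy => hf₀ (congrArg Subtype.val hxy), fun x => ?_⟩
    have hcl : IsClosed (f₀.range : Set A) :=
      (NonUnitalStarAlgHom.isometry f₀ hf₀).isClosedEmbedding.isClosed_range
    obtain ⟨z, hz⟩ := StarAlgebra.elemental.le_of_mem hcl
      ⟨⟨(a, b), StarAlgebra.elemental.self_mem ℂ (a, b)⟩, rfl⟩ x.2
    exact ⟨z, Subtype.ext hz⟩
  let F : D ≃⋆ₐ[ℂ] StarAlgebra.elemental ℂ a := StarAlgEquiv.ofBijective f hf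
  refine ⟨k.comp (F.symm : StarAlgebra.elemental ℂ a →⋆ₐ[ℂ] D), ?_⟩
  have hF : F.symm ⟨a, StarAlgebra.elemental.self_mem ℂ a⟩ =
      ⟨(a, b), StarAlgebra.elemental.self_mem ℂ (a, b)⟩ := by
    rw [StarAlgEquiv.symm_apply_eq]
    rfl
  change k (F.symm _) = _
  rw [hF]
  rfl

/-- Intertwining relations for a generator and its adjoint pass to the generated C*-algebra. -/
theorem intertwines_of_mem_elemental {P E F : Type*} [CStarAlgebra P]
    [NormedAddCommGroup E] [InnerProductSpace ℂ E] [CompleteSpace E]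
    [NormedAddCommGroup F] [InnerProductSpace ℂ F] [CompleteSpace F]
    (f : P →⋆ₐ[ℂ] (E →L[ℂ] E)) (g : P →⋆ₐ[ℂ] (F →L[ℂ] F)) (V : E →L[ℂ] F) {p : P}
    (h : g p ∘L V = V ∘L f p) (h' : star (g p) ∘L V = V ∘L star (f p))
    {z : P} (hz : z ∈ StarAlgebra.elemental ℂ p) : g z ∘L V = V ∘L f z := by
  have hf : Continuous f := map_continuous f
  have hg : Continuous g := map_continuous g
  induction hz using StarAlgebra.elemental.induction_on with
  | self => exact h
  | star_self => simpa only [map_star] using h'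
  | algebraMap r =>
    ext x
    simp [Algebra.algebraMap_eq_smul_one]
  | add u hu v hv hu' hv' => simp only [map_add, add_comp, comp_add, hu', hv']
  | mul u hu v hv hu' hv' =>
    rw [map_mul, map_mul, ContinuousLinearMap.mul_def, ContinuousLinearMap.mul_def, comp_assoc,
      hv', ← comp_assoc, hu', comp_assoc]
  | closure s hs h v hv =>
    have hc : IsClosed {w : P | g w ∘L V = V ∘L f w} :=
      isClosed_eq (by fun_prop) (by fun_prop)
    exact closure_minimal (fun w hw => h w hw) hc hv

/-- Approximate eigenvectors for a generator and its adjoint are approximate eigenvectors for the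
whole generated C*-algebra. -/
theorem tendsto_sub_smul_of_mem_elemental {P E : Type*} [CStarAlgebra P]
    [NormedAddCommGroup E] [InnerProductSpace ℂ E] [CompleteSpace E]
    (f : P →⋆ₐ[ℂ] (E →L[ℂ] E)) (φ : P →⋆ₐ[ℂ] ℂ) {u : ℕ → E} (hu : ∀ n, ‖u n‖ = 1) {p : P}
    (h : Tendsto (fun n => f p (u n) - φ p • u n) atTop (𝓝 0))
    (h' : Tendsto (fun n => star (f p) (u n) - star (φ p) • u n) atTop (𝓝 0))
    {z : P} (hz : z ∈ StarAlgebra.elemental ℂ p) :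
    Tendsto (fun n => f z (u n) - φ z • u n) atTop (𝓝 0) := by
  induction hz using StarAlgebra.elemental.induction_on with
  | self => exact h
  | star_self => simpa only [map_star] using h'
  | algebraMap r => simp [Algebra.algebraMap_eq_smul_one]
  | add x hx y hy hx' hy' =>
    convert hx'.add hy' using 2 with n
    · simp only [map_add, add_apply, add_smul]
      abel
    · simp
  | mul x hx y hy hx' hy' =>
    convert (((f x).continuous.tendsto 0).comp hy').add (hx'.const_smul (φ y)) using 2 with n
    · simp only [map_mul, mul_apply_eq_comp, Function.comp_apply, map_sub, map_smul,
        smul_sub, smul_smul, mul_comm (φ y)]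
      abel
    · simp
  | closure s hs h v hv =>
    rw [Metric.tendsto_atTop]
    intro ε hε
    obtain ⟨w, hw, hvw⟩ := Metric.mem_closure_iff.1 hv (ε / 3) (by positivity)
    obtain ⟨N, hN⟩ := Metric.tendsto_atTop.1 (h w hw) (ε / 3) (by positivity)
    refine ⟨N, fun n hn => ?_⟩
    have h1 := hN n hn
    rw [dist_zero_right] at h1 ⊢
    rw [dist_eq_norm] at hvw
    have h2 : ‖f (v - w) (u n)‖ ≤ ‖v - w‖ := by
      have h3 := (f (v - w)).le_opNorm (u n)
      rw [hu, mul_one] at h3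
      exact h3.trans (NonUnitalStarAlgHom.norm_apply_le f _)
    have h3 : ‖φ (v - w) • u n‖ ≤ ‖v - w‖ := by
      rw [norm_smul, hu, mul_one]
      exact NonUnitalStarAlgHom.norm_apply_le φ _
    have h4 : f v (u n) - φ v • u n =
        f (v - w) (u n) - φ (v - w) • u n + (f w (u n) - φ w • u n) := by
      simp only [map_sub, sub_apply, sub_smul]
      abel
    rw [h4]
    refine (norm_add_le _ _).trans_lt ?_
    have := norm_sub_le (f (v - w) (u n)) (φ (v - w) • u n)
    linarith

/-- Continuous linear maps agreeing on a Hilbert basis are equal. -/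
theorem HilbertBasis.clm_ext {G : Type*} [NormedAddCommGroup G]
    [InnerProductSpace ℂ G] (e : HilbertBasis ℕ ℂ G) {F : Type*} [NormedAddCommGroup F] [InnerProductSpace ℂ F]
    {A B : G →L[ℂ] F} (h : ∀ k, A (e k) = B (e k)) : A = B := by
  refine ContinuousLinearMap.ext_on (s := Set.range e) ?_ ?_
  · rw [dense_iff_closure_eq, ← Submodule.topologicalClosure_coe, e.dense_span]
    rfl
  · rintro _ ⟨k, rfl⟩
    exact h k

section Shift

variable {G : Type*} [NormedAddCommGroup G] [InnerProductSpace ℂ G] [CompleteSpace G]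
  (e : HilbertBasis ℕ ℂ G) {S : G →L[ℂ] G}

theorem star_shift_zero (hS : ∀ k : ℕ, S (e k) = e (k + 1)) : star S (e 0) = 0 := by
  apply e.repr.injective
  ext i
  rw [e.repr_apply_apply, star_eq_adjoint, adjoint_inner_right, hS, LinearIsometryEquiv.map_zero]
  exact e.orthonormal.2 (Nat.succ_ne_zero i)

theorem star_shift_succ (hS : ∀ k : ℕ, S (e k) = e (k + 1)) (k : ℕ) :
    star S (e (k + 1)) = e k := by
  apply e.repr.injective
  ext i
  rw [e.repr_apply_apply, e.repr_apply_apply, star_eq_adjoint, adjoint_inner_right, hS,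
    orthonormal_iff_ite.1 e.orthonormal, orthonormal_iff_ite.1 e.orthonormal]
  simp

theorem star_shift_mul_shift (hS : ∀ k : ℕ, S (e k) = e (k + 1)) : star S * S = 1 := by
  refine e.clm_ext fun k => ?_
  simp [hS, star_shift_succ e hS]

/-- The shift has approximate eigenvectors at every point of the unit circle. -/
theorem exists_approx_eigenvector_shift (hS : ∀ k : ℕ, S (e k) = e (k + 1)) {c : ℂ}
    (hc : ‖c‖ = 1) : ∃ u : ℕ → G, (∀ n, ‖u n‖ = 1) ∧
      Tendsto (fun n => S (u n) - c • u n) atTop (𝓝 0) ∧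
      Tendsto (fun n => star S (u n) - star c • u n) atTop (𝓝 0) := by
  have hcc : c * star c = 1 := by
    rw [← starRingEnd_apply, Complex.mul_conj, Complex.normSq_eq_norm_sq, hc]
    norm_num
  let v : ℕ → G := fun m => ∑ k ∈ Finset.range m, star c ^ k • e k
  have hv (m : ℕ) : S (v m) - c • v m = c • (star c ^ m • e m - e 0) := by
    induction m with
    | zero => simp [v]
    | succ m ih =>
      have hsucc : v (m + 1) = v m + star c ^ m • e m := Finset.sum_range_succ _ _
      have hcm : c * star c ^ (m + 1) = star c ^ m := by
        rw [pow_succ', ← mul_assoc, hcc, one_mul]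
      rw [hsucc, map_add, smul_add, add_sub_add_comm, ih, map_smul, hS]
      simp only [smul_sub, smul_smul, hcm]
      abel
  have hnv (m : ℕ) : ‖v m‖ = √m := by
    have h : inner ℂ (v m) (v m) = (m : ℂ) := by
      rw [e.orthonormal.inner_sum]
      have h1 (k : ℕ) : (starRingEnd ℂ) (star c ^ k) * star c ^ k = 1 := by
        rw [starRingEnd_apply, star_pow, star_star, ← mul_pow, hcc, one_pow]
      rw [Finset.sum_congr rfl fun k _ => h1 k]
      simp
    rw [@norm_eq_sqrt_re_inner ℂ, h]
    simp
  let r : ℕ → ℂ := fun n => ((√((n + 1 : ℕ) : ℝ))⁻¹ : ℝ)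
  have hr (n : ℕ) : ‖r n‖ = (√((n + 1 : ℕ) : ℝ))⁻¹ := by
    rw [Complex.norm_real, Real.norm_of_nonneg (by positivity)]
  have hr0 : Tendsto (fun n => ‖r n‖ * 2) atTop (𝓝 0) := by
    simp only [hr]
    have h1 : Tendsto (fun n : ℕ => √((n + 1 : ℕ) : ℝ)) atTop atTop :=
      Real.tendsto_sqrt_atTop.comp
        ((tendsto_natCast_atTop_atTop (R := ℝ)).comp (tendsto_add_atTop_nat 1))
    simpa using h1.inv_tendsto_atTop.mul_const 2
  have hu : ∀ n, ‖r n • v (n + 1)‖ = 1 := fun n => by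
    rw [norm_smul, hr, hnv, inv_mul_cancel₀]
    positivity
  have hlim : Tendsto (fun n => S (r n • v (n + 1)) - c • r n • v (n + 1)) atTop (𝓝 0) := by
    refine squeeze_zero_norm (fun n => ?_) hr0
    rw [map_smul, smul_comm c, ← smul_sub, norm_smul, hv, norm_smul, hc, one_mul]
    refine mul_le_mul_of_nonneg_left ((norm_sub_le _ _).trans_eq ?_) (norm_nonneg _)
    rw [norm_smul, norm_pow, norm_star, hc, e.orthonormal.1, e.orthonormal.1]
    norm_num
  refine ⟨fun n => r n • v (n + 1), hu, hlim, ?_⟩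
  have hlim' := (((star S).continuous.tendsto 0).comp hlim).const_smul (-star c)
  rw [map_zero, smul_zero] at hlim'
  refine hlim'.congr fun n => ?_
  have hSS (x : G) : star S (S x) = x := DFunLike.congr_fun (star_shift_mul_shift e hS) x
  simp only [Function.comp_apply]
  generalize r n • v (n + 1) = x
  rw [map_sub, hSS, map_smul, smul_sub, smul_smul, neg_mul, mul_comm, hcc]
  simp only [neg_smul, one_smul]
  abel

/-- A unit vector `ξ` whose orbit under `A` behaves like that of a wandering vector of an isometry
gives a map intertwining `A` with the shift. -/
theorem exists_shift_intertwiner (hS : ∀ k : ℕ, S (e k) = e (k + 1)) {H : Type*}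
    [NormedAddCommGroup H] [InnerProductSpace ℂ H] [CompleteSpace H] {A : H →L[ℂ] H} {ξ : H}
    (hξ : ‖ξ‖ = 1) (h0 : star A ξ = 0) (hA : ∀ n : ℕ, star A ((A ^ (n + 1)) ξ) = (A ^ n) ξ) :
    ∃ V : G →L[ℂ] H, (∀ k, V (e k) = (A ^ k) ξ) ∧ A ∘L V = V ∘L S ∧
      star A ∘L V = V ∘L star S := by
  have hpow (n : ℕ) (x : H) : (A ^ (n + 1)) x = A ((A ^ n) x) := by
    rw [pow_succ', mul_apply_eq_comp]
  have hinner (i m : ℕ) : inner ℂ ((A ^ i) ξ) ((A ^ (i + m)) ξ) = inner ℂ ξ ((A ^ m) ξ) := by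
    induction i with
    | zero => simp
    | succ i ih =>
      rw [hpow, ← adjoint_inner_right, ← star_eq_adjoint, Nat.add_right_comm, hA, ih]
  have hlt {i j : ℕ} (hij : i < j) : inner ℂ ((A ^ i) ξ) ((A ^ j) ξ) = 0 := by
    obtain ⟨m, rfl⟩ := Nat.exists_eq_add_of_lt hij
    rw [Nat.add_assoc, hinner, hpow, ← adjoint_inner_left, ← star_eq_adjoint, h0,
      inner_zero_left]
  have hon : Orthonormal ℂ fun k : ℕ => (A ^ k) ξ := by
    refine ⟨fun i => ?_, fun i j hij => ?_⟩
    · rw [@norm_eq_sqrt_re_inner ℂ]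
      have := hinner i 0
      simp only [Nat.add_zero, pow_zero, one_apply_eq_self] at this
      rw [this]
      simp [hξ]
    · rcases hij.lt_or_gt with h | h
      · exact hlt h
      · exact inner_eq_zero_symm.1 (hlt h)
  let V : G →L[ℂ] H := hon.orthogonalFamily.linearIsometry.toContinuousLinearMap ∘L
    (e.repr : G →L[ℂ] lp (fun _ : ℕ => ℂ) 2)
  have hV (k : ℕ) : V (e k) = (A ^ k) ξ := by
    change hon.orthogonalFamily.linearIsometry (e.repr (e k)) = _
    rw [e.repr_self, OrthogonalFamily.linearIsometry_apply_single]
    simp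
  clear_value V
  refine ⟨V, hV, e.clm_ext fun k => ?_, e.clm_ext fun k => ?_⟩
  · rw [comp_apply, comp_apply, hS, hV, hV, hpow]
  · rw [comp_apply, comp_apply, hV]
    cases k with
    | zero => rw [star_shift_zero e hS, map_zero, pow_zero, one_apply_eq_self, h0]
    | succ k => rw [star_shift_succ e hS, hA, hV]

/-- An operator that kills everything intertwining the shift with `A` kills the pure isometric
part of `A`. -/
theorem mul_pow_mul_eq_zero_of_comp_eq_zero (hS : ∀ k : ℕ, S (e k) = e (k + 1)) {H : Type*}
    [NormedAddCommGroup H] [InnerProductSpace ℂ H] [CompleteSpace H] {A y : H →L[ℂ] H}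
    (hA : A * star A * A = A)
    (hrel : ∀ n : ℕ, (1 - star A * A) * A ^ n * (1 - A * star A) = 0)
    (hy : ∀ V : G →L[ℂ] H, A ∘L V = V ∘L S → star A ∘L V = V ∘L star S → y ∘L V = 0) (n : ℕ) :
    y * A ^ n * (1 - A * star A) = 0 := by
  have hA' : star A * A * star A = star A := by
    simpa [mul_assoc] using congrArg star hA
  have key (ξ : H) (hξ : ‖ξ‖ = 1) (h0 : star A ξ = 0) : y ((A ^ n) ξ) = 0 := by
    obtain ⟨V, hV, h1, h2⟩ := exists_shift_intertwiner e hS hξ h0 fun m => by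
      have h := DFunLike.congr_fun (hrel m) ξ
      simp only [mul_apply_eq_comp, sub_apply, one_apply_eq_self, h0, map_zero, sub_zero,
        zero_apply] at h
      rw [pow_succ', mul_apply_eq_comp]
      exact (sub_eq_zero.1 h).symm
    rw [← hV]
    exact DFunLike.congr_fun (hy V h1 h2) (e n)
  ext x
  have hx : star A ((1 - A * star A) x) = 0 := by
    rw [← mul_apply_eq_comp, mul_sub, mul_one, ← mul_assoc, hA', sub_self, zero_apply]
  rw [mul_apply_eq_comp, mul_apply_eq_comp, zero_apply]
  generalize (1 - A * star A) x = ξ at hx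
  rcases eq_or_ne ξ 0 with rfl | hξ
  · simp
  · have hn : (‖ξ‖ : ℂ) ≠ 0 := by simpa using hξ
    have h := key ((‖ξ‖ : ℂ)⁻¹ • ξ) (norm_smul_inv_norm hξ) (by rw [map_smul, hx, smul_zero])
    rw [map_smul, map_smul] at h
    exact (smul_eq_zero.1 h).resolve_left (inv_ne_zero hn)

end Shift

/-- A unitary element of a commutative C*-algebra is dominated by any operator with approximate
eigenvectors at every point of the unit circle. -/
theorem eq_zero_of_approx_eigenvectors {P C E : Type*} [CStarAlgebra P] [CommCStarAlgebra C]
    [NormedAddCommGroup E] [InnerProductSpace ℂ E] [CompleteSpace E]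
    (f : P →⋆ₐ[ℂ] (E →L[ℂ] E)) (g : P →⋆ₐ[ℂ] C) {p : P} (hp : star (g p) * g p = 1)
    (hf : ∀ c : ℂ, ‖c‖ = 1 → ∃ u : ℕ → E, (∀ n, ‖u n‖ = 1) ∧
      Tendsto (fun n => f p (u n) - c • u n) atTop (𝓝 0) ∧
      Tendsto (fun n => star (f p) (u n) - star c • u n) atTop (𝓝 0))
    {z : P} (hz : z ∈ StarAlgebra.elemental ℂ p) (hfz : f z = 0) : g z = 0 := by
  apply (gelfandTransform_isometry C).injective
  rw [map_zero]
  ext φ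
  let ψ : P →⋆ₐ[ℂ] ℂ := (φ : C →⋆ₐ[ℂ] ℂ).comp g
  have hψ : ‖ψ p‖ = 1 := by
    have h : star (ψ p) * ψ p = 1 := by
      have h := congrArg (φ : C →⋆ₐ[ℂ] ℂ) hp
      rwa [map_mul, map_star, map_one] at h
    have h' := CStarRing.norm_star_mul_self (x := ψ p)
    rw [h, norm_one] at h'
    nlinarith [norm_nonneg (ψ p)]
  obtain ⟨u, hu, h1, h2⟩ := hf (ψ p) hψ
  have h := (tendsto_sub_smul_of_mem_elemental f ψ hu h1 h2 hz).norm
  simp only [hfz, zero_apply, zero_sub, norm_neg, norm_smul, hu, mul_one, norm_zero] at h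
  exact norm_eq_zero.1 (tendsto_nhds_unique tendsto_const_nhds h)

/-- The unitary part of a partial isometry: a reducing subspace on which it acts unitarily, and
which contains every vector orthogonal to the orbits of the defect spaces. -/
theorem exists_unitary_part {H : Type*} [NormedAddCommGroup H] [InnerProductSpace ℂ H]
    [CompleteSpace H] (R : H →L[ℂ] H) :
    ∃ (K : Submodule ℂ H) (_ : CompleteSpace K) (U : K →L[ℂ] K),
      star U * U = 1 ∧ U * star U = 1 ∧ R ∘L K.subtypeL = K.subtypeL ∘L U ∧
      star R ∘L K.subtypeL = K.subtypeL ∘L star U ∧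
      ∀ x, (∀ n, ((1 - R * star R) * star R ^ n : H →L[ℂ] H) x = 0) →
        (∀ n, ((1 - star R * R) * R ^ n : H →L[ℂ] H) x = 0) → x ∈ K := by
  let K : Submodule ℂ H :=
    (⨅ n : ℕ, ((1 - R * star R) * star R ^ n : H →L[ℂ] H).ker) ⊓ ⨅ n : ℕ, ((1 - star R * R) * R ^ n : H →L[ℂ] H).ker
  have hK (x : H) : x ∈ K ↔ (∀ n, ((1 - R * star R) * star R ^ n : H →L[ℂ] H) x = 0) ∧
      ∀ n, ((1 - star R * R) * R ^ n : H →L[ℂ] H) x = 0 := by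
    simp only [K, Submodule.mem_inf, Submodule.mem_iInf, LinearMap.mem_ker]
    rfl
  have hcl : IsClosed (K : Set H) := by
    have : (K : Set H) = (⋂ n : ℕ, {x | ((1 - R * star R) * star R ^ n : H →L[ℂ] H) x = 0}) ∩
        ⋂ n : ℕ, {x | ((1 - star R * R) * R ^ n : H →L[ℂ] H) x = 0} := by
      ext x
      simp only [SetLike.mem_coe, hK x, Set.mem_inter_iff, Set.mem_iInter, Set.mem_ofPred_eq]
    rw [this]
    exact (isClosed_iInter fun n => isClosed_eq (by fun_prop) (by fun_prop)).inter
      (isClosed_iInter fun n => isClosed_eq (by fun_prop) (by fun_prop))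
  have hKc : CompleteSpace K := hcl.completeSpace_coe
  have hRR (x : H) (hx : x ∈ K) : star R (R x) = x := by
    have h := ((hK x).1 hx).2 0
    rw [pow_zero, mul_one, sub_apply] at h
    exact (sub_eq_zero.1 h).symm
  have hRR' (x : H) (hx : x ∈ K) : R (star R x) = x := by
    have h := ((hK x).1 hx).1 0
    rw [pow_zero, mul_one, sub_apply] at h
    exact (sub_eq_zero.1 h).symm
  have hmap (x : H) (hx : x ∈ K) : R x ∈ K := by
    refine (hK _).2 ⟨fun n => ?_, fun n => ?_⟩
    · cases n with
      | zero =>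
        rw [pow_zero, mul_one, sub_apply, mul_apply_eq_comp, hRR x hx, one_apply_eq_self, sub_self]
      | succ n =>
        rw [pow_succ, ← mul_assoc, mul_apply_eq_comp, hRR x hx]
        exact ((hK x).1 hx).1 n
    · rw [← mul_apply_eq_comp, mul_assoc, ← pow_succ]
      exact ((hK x).1 hx).2 (n + 1)
  have hmap' (x : H) (hx : x ∈ K) : star R x ∈ K := by
    refine (hK _).2 ⟨fun n => ?_, fun n => ?_⟩
    · rw [← mul_apply_eq_comp, mul_assoc, ← pow_succ]
      exact ((hK x).1 hx).1 (n + 1)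
    · cases n with
      | zero =>
        rw [pow_zero, mul_one, sub_apply, mul_apply_eq_comp, hRR' x hx, one_apply_eq_self,
          sub_self]
      | succ n =>
        rw [pow_succ, ← mul_assoc, mul_apply_eq_comp, hRR' x hx]
        exact ((hK x).1 hx).2 n
  let U : K →L[ℂ] K := (R ∘L K.subtypeL).codRestrict K fun x => hmap x x.2
  let U' : K →L[ℂ] K := (star R ∘L K.subtypeL).codRestrict K fun x => hmap' x x.2
  have hU : star U = U' := by
    symm
    rw [star_eq_adjoint, eq_adjoint_iff]
    intro x y
    change inner ℂ (star R (x : H)) (y : H) = inner ℂ (x : H) (R (y : H))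
    rw [star_eq_adjoint, adjoint_inner_left]
  refine ⟨K, hKc, U, ?_, ?_, rfl, ?_, fun x h1 h2 => (hK x).2 ⟨h1, h2⟩⟩
  · rw [hU]
    ext x
    exact hRR x x.2
  · rw [hU]
    ext x
    exact hRR' x x.2
  · rw [hU]
    rfl

/-- The adjoint of `S ⊕ S*` is `S* ⊕ S`. -/
theorem star_shift_sum_apply {G : Type*} [NormedAddCommGroup G] [InnerProductSpace ℂ G]
    [CompleteSpace G] {S : G →L[ℂ] G} {T : WithLp 2 (G × G) →L[ℂ] WithLp 2 (G × G)}
    (hT : ∀ x, T x = WithLp.toLp 2 (S x.fst, star S x.snd)) (x : WithLp 2 (G × G)) :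
    star T x = WithLp.toLp 2 (star S x.fst, S x.snd) := by
  refine ext_inner_right ℂ fun y => ?_
  rw [star_eq_adjoint, adjoint_inner_left, hT, WithLp.prod_inner_apply, WithLp.prod_inner_apply]
  simp [star_eq_adjoint, adjoint_inner_left, adjoint_inner_right]

/-- The universal property of `C*(S ⊕ S*)`, given the unitary part `U` of `R`. -/
theorem exists_starAlgHom_of_unitary_part
    {G : Type*} [NormedAddCommGroup G] [InnerProductSpace ℂ G] [CompleteSpace G]
    (e : HilbertBasis ℕ ℂ G) (S : G →L[ℂ] G) (hS : ∀ k : ℕ, S (e k) = e (k + 1))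
    (T : WithLp 2 (G × G) →L[ℂ] WithLp 2 (G × G))
    (hT : T = (WithLp.prodContinuousLinearEquiv 2 ℂ G G).symm.toContinuousLinearMap ∘L
        (S.prodMap (star S)) ∘L
        (WithLp.prodContinuousLinearEquiv 2 ℂ G G).toContinuousLinearMap)
    {H : Type*} [NormedAddCommGroup H] [InnerProductSpace ℂ H] [CompleteSpace H]
    (R : H →L[ℂ] H)
    (hR : R * star R * R = R)
    (hrel : ∀ n : ℕ, (1 - star R * R) * R ^ n * (1 - R * star R) = 0)
    {K : Type*} [NormedAddCommGroup K] [InnerProductSpace ℂ K] [CompleteSpace K]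
    (ι : K →L[ℂ] H) {U : K →L[ℂ] K} (hU : star U * U = 1) (hU' : U * star U = 1)
    (hι : R ∘L ι = ι ∘L U) (hι' : star R ∘L ι = ι ∘L star U)
    (hK : ∀ x, (∀ n, ((1 - R * star R) * star R ^ n : H →L[ℂ] H) x = 0) →
      (∀ n, ((1 - star R * R) * R ^ n : H →L[ℂ] H) x = 0) → x ∈ Set.range ι) :
    ∃ π : StarAlgebra.elemental ℂ T →⋆ₐ[ℂ] StarAlgebra.elemental ℂ R,
      π ⟨T, StarAlgebra.elemental.self_mem ℂ T⟩ = ⟨R, StarAlgebra.elemental.self_mem ℂ R⟩ := by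
  have hTx (x : WithLp 2 (G × G)) : T x = WithLp.toLp 2 (S x.fst, star S x.snd) := by
    rw [hT]
    rfl
  have hTx' := star_shift_sum_apply hTx
  have : IsStarNormal U := ⟨by rw [Commute, SemiconjBy, hU, hU']⟩
  let C := StarAlgebra.elemental ℂ U
  let u : C := ⟨U, StarAlgebra.elemental.self_mem ℂ U⟩
  refine exists_elemental_starAlgHom_of_prod T (R, u) (StarAlgHom.fst ℂ (H →L[ℂ] H) C) ?_
  intro z hz hz1
  let P := (WithLp 2 (G × G) →L[ℂ] WithLp 2 (G × G)) × ((H →L[ℂ] H) × C)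
  let f : P →⋆ₐ[ℂ] (WithLp 2 (G × G) →L[ℂ] WithLp 2 (G × G)) := StarAlgHom.fst ℂ _ _
  let g : P →⋆ₐ[ℂ] (H →L[ℂ] H) := (StarAlgHom.fst ℂ _ _).comp (StarAlgHom.snd ℂ _ _)
  let k : P →⋆ₐ[ℂ] C := (StarAlgHom.snd ℂ _ _).comp (StarAlgHom.snd ℂ _ _)
  have hw : k z = 0 := by
    refine eq_zero_of_approx_eigenvectors f k (p := (T, (R, u))) (Subtype.ext hU)
      (fun c hc => ?_) hz hz1
    obtain ⟨v, hv, h1, h2⟩ := exists_approx_eigenvector_shift e hS hc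
    refine ⟨fun n => WithLp.toLp 2 (v n, 0), fun n => ?_, ?_, ?_⟩
    · rw [WithLp.norm_toLp_fst, hv]
    · refine squeeze_zero_norm (fun n => le_of_eq ?_) (tendsto_zero_iff_norm_tendsto_zero.1 h1)
      change ‖T _ - _‖ = _
      rw [hTx, ← WithLp.norm_toLp_fst 2 G G]
      rw [← WithLp.toLp_smul, ← WithLp.toLp_sub]
      simp
    · refine squeeze_zero_norm (fun n => le_of_eq ?_) (tendsto_zero_iff_norm_tendsto_zero.1 h2)
      change ‖star T _ - _‖ = _
      rw [hTx', ← WithLp.norm_toLp_fst 2 G G]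
      rw [← WithLp.toLp_smul, ← WithLp.toLp_sub]
      simp
  have hyK : g z ∘L ι = 0 := by
    have h := intertwines_of_mem_elemental (C.subtype.comp k) g ι
      (p := (T, (R, u))) hι hι' hz
    rw [h, StarAlgHom.comp_apply, hw, map_zero, comp_zero]
  have hy1 := mul_pow_mul_eq_zero_of_comp_eq_zero e hS (y := g z) hR hrel fun V h1 h2 => by
    have h := intertwines_of_mem_elemental f g (V ∘L WithLp.fstL 2 ℂ G G) (p := (T, (R, u)))
      (z := z) (by
        change R ∘L _ = _ ∘L T
        rw [← comp_assoc, h1]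
        ext x
        simp [hTx]) (by
        change star R ∘L _ = _ ∘L star T
        rw [← comp_assoc, h2]
        ext x
        simp only [comp_apply, hTx', WithLp.fstL_apply]
        rfl) hz
    have hfz : f z = 0 := hz1
    rw [hfz, comp_zero] at h
    ext x
    exact DFunLike.congr_fun h (WithLp.toLp 2 (x, 0))
  have hy2 := mul_pow_mul_eq_zero_of_comp_eq_zero e hS (A := star R) (y := g z)
    (by simpa [mul_assoc] using congrArg star hR)
    (fun n => by simpa [mul_assoc] using congrArg star (hrel n)) fun V h1 h2 => by
    rw [star_star] at h2
    have h := intertwines_of_mem_elemental f g (V ∘L WithLp.sndL 2 ℂ G G) (p := (T, (R, u)))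
      (z := z) (by
        change R ∘L _ = _ ∘L T
        rw [← comp_assoc, h2]
        ext x
        simp only [comp_apply, hTx, WithLp.sndL_apply]
        rfl) (by
        change star R ∘L _ = _ ∘L star T
        rw [← comp_assoc, h1]
        ext x
        simp only [comp_apply, hTx', WithLp.sndL_apply]
        rfl) hz
    have hfz : f z = 0 := hz1
    rw [hfz, comp_zero] at h
    ext x
    exact DFunLike.congr_fun h (WithLp.toLp 2 (0, x))
  have hmem (x : H) : star (g z) x ∈ Set.range ι := by
    refine hK _ (fun n => ?_) fun n => ?_
    · have h := congrArg star (hy1 n)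
      simp only [star_mul, star_sub, star_one, star_star, star_pow, star_zero, ← mul_assoc] at h
      exact DFunLike.congr_fun h x
    · have h := congrArg star (hy2 n)
      simp only [star_mul, star_sub, star_one, star_star, star_pow, star_zero, ← mul_assoc] at h
      exact DFunLike.congr_fun h x
  have hy : g z = 0 := by
    rw [← CStarRing.mul_star_self_eq_zero_iff]
    ext x
    obtain ⟨w, hw⟩ := hmem x
    rw [mul_apply_eq_comp, ← hw]
    exact DFunLike.congr_fun hyK w
  exact Prod.ext hy hw

/-- Universal property of `C*(S ⊕ S*)`: if `R` is a proper partial isometry (neither an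
isometry nor a coisometry) satisfying `(1 - R*R) Rⁿ (1 - RR*) = 0` for all `n ≥ 0`, then
there is a unital *-homomorphism `π : C*(S ⊕ S*) → C*(R)` with `π(S ⊕ S*) = R`, where
`S` is the unilateral shift. -/
theorem shift_plus_adjoint_universal_property
    {G : Type*} [NormedAddCommGroup G] [InnerProductSpace ℂ G] [CompleteSpace G]
    (e : HilbertBasis ℕ ℂ G) (S : G →L[ℂ] G) (hS : ∀ k : ℕ, S (e k) = e (k + 1))
    (T : WithLp 2 (G × G) →L[ℂ] WithLp 2 (G × G))
    (hT : T = (WithLp.prodContinuousLinearEquiv 2 ℂ G G).symm.toContinuousLinearMap ∘L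
        (S.prodMap (star S)) ∘L
        (WithLp.prodContinuousLinearEquiv 2 ℂ G G).toContinuousLinearMap)
    {H : Type*} [NormedAddCommGroup H] [InnerProductSpace ℂ H] [CompleteSpace H]
    (R : H →L[ℂ] H)
    (hR : R * star R * R = R)
    (hrel : ∀ n : ℕ, (1 - star R * R) * R ^ n * (1 - R * star R) = 0)
    (hproper₁ : R * star R ≠ 1) (hproper₂ : star R * R ≠ 1) :
    ∃ π : StarAlgebra.elemental ℂ T →⋆ₐ[ℂ] StarAlgebra.elemental ℂ R,
      π ⟨T, StarAlgebra.elemental.self_mem ℂ T⟩ = ⟨R, StarAlgebra.elemental.self_mem ℂ R⟩ := by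
  obtain ⟨K, _, U, hU, hU', hι, hι', hK⟩ := exists_unitary_part R
  exact exists_starAlgHom_of_unitary_part e S hS T hT R hR hrel K.subtypeL hU hU' hι hι'
    fun x h1 h2 => ⟨⟨x, hK x h1 h2⟩, rfl⟩
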